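/- arXiv:1505.03587 — 5 statements merged into one kernel-verified Lean document; each statement's English description precedes it below -/
import Mathlib

section
/- For every binary string x of length n, the nondeterministic automatic complexity of x is at most ⌊n/2⌋ + 1; that is, there exists a nondeterministic finite automaton over the alphabet {0,1} with at most ⌊n/2⌋ + 1 states (and no ε-transitions) that accepts x, and such that among all pairs (w, p) where w is a string of length n and p is an accepting path of length n in the automaton, the only such pair is (x, together with a unique accepting path for x). -/
/-- An accepting path of length `n` for the word `w : Fin n → Bool` in the NFA `M`:
a sequence of `n + 1` states starting in a start state, ending in an accept state,
following the transition relation while reading `w`. -/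
def AcceptingPath {σ : Type*} (M : NFA Bool σ) {n : ℕ}
    (w : Fin n → Bool) (p : Fin (n + 1) → σ) : Prop :=
  p 0 ∈ M.start ∧ p (Fin.last n) ∈ M.accept ∧
    ∀ i : Fin n, p i.succ ∈ M.step (p i.castSucc) (w i)

/-- The walk `0, 1, …, m, m, m - 1, …` which traverses a path graph with a loop at its end `m`. -/
def foldedWalk (m i : ℕ) : ℕ := min i (2 * m + 1 - i)

/-- The only walk of length `n ≤ 2 * m + 1` from `0` to `foldedWalk m n` on the path `0, …, m` with
a loop at `m` is `foldedWalk m`, provided that `n / 2 = m`. -/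
theorem eq_foldedWalk {n m : ℕ} (hm : n / 2 = m) {q : Fin (n + 1) → ℕ} (hle : ∀ i, q i ≤ m)
    (h0 : q 0 = 0) (hlast : q (Fin.last n) = foldedWalk m n)
    (hstep : ∀ i : Fin n, q i.succ = q i.castSucc + 1 ∨ q i.castSucc = q i.succ + 1 ∨
      q i.castSucc = m ∧ q i.succ = m) (i : Fin (n + 1)) :
    q i = foldedWalk m i := by
  have forward : ∀ i : Fin (n + 1), ((q i + i) % 2 = 0 ∧ q i ≤ i) ∨
      ((q i + i) % 2 = 1 ∧ 2 * m + 1 ≤ q i + i) := by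
    intro i
    induction i using Fin.induction with
    | zero => simp [h0]
    | succ i ih =>
      have := hstep i
      simp only [Fin.val_castSucc, Fin.val_succ] at ih ⊢
      omega
  have backward : ∀ i : Fin (n + 1), ((q i + i) % 2 = 0 ∧ i ≤ q i) ∨
      ((q i + i) % 2 = 1 ∧ q i + i ≤ 2 * m + 1) := by
    intro i
    induction i using Fin.reverseInduction with
    | last =>
      rw [hlast]
      simp only [Fin.val_last, foldedWalk]
      omega
    | cast i ih =>
      have := hstep i
      simp only [Fin.val_castSucc, Fin.val_succ] at ih ⊢
      omega
  have := forward i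
  have := backward i
  have := hle i
  unfold foldedWalk
  omega

/-- Every binary string `x` of length `n` is accepted by an NFA with at most
`⌊n/2⌋ + 1` states for which `(x, its accepting path)` is the unique pair of a
word of length `n` together with an accepting path of length `n`. -/
theorem nondeterministic_automatic_complexity_le (n : ℕ) (x : Fin n → Bool) :
    ∃ (m : ℕ) (M : NFA Bool (Fin m)), m ≤ n / 2 + 1 ∧
      ∃ p : Fin (n + 1) → Fin m, AcceptingPath M x p ∧
        ∀ (w : Fin n → Bool) (q : Fin (n + 1) → Fin m),
          AcceptingPath M w q → w = x ∧ q = p := by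
  let p : Fin (n + 1) → Fin (n / 2 + 1) := fun i =>
    ⟨foldedWalk (n / 2) i, by unfold foldedWalk; omega⟩
  let M : NFA Bool (Fin (n / 2 + 1)) :=
    { step := fun s b => {t | ∃ i : Fin n, p i.castSucc = s ∧ p i.succ = t ∧ x i = b}
      start := {0}
      accept := {p (Fin.last n)} }
  refine ⟨n / 2 + 1, M, le_rfl, p, ⟨?_, rfl, fun i => ⟨i, rfl, rfl, rfl⟩⟩, ?_⟩
  · exact Fin.ext (by simp [p, foldedWalk])
  rintro w q ⟨hstart, haccept, hstep⟩
  have hq : q = p := by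
    funext i
    refine Fin.ext (eq_foldedWalk rfl (q := fun i => (q i : ℕ)) (fun i => by omega)
      (congrArg Fin.val hstart) (congrArg Fin.val haccept) (fun i => ?_) i)
    obtain ⟨j, hj, hj', -⟩ := hstep i
    simp only [← hj, ← hj', p, foldedWalk, Fin.val_castSucc, Fin.val_succ]
    omega
  subst hq
  refine ⟨funext fun i => ?_, rfl⟩
  obtain ⟨j, hj, hj', hx⟩ := hstep i
  have hji : j = i := by
    simp only [p, foldedWalk, Fin.mk.injEq, Fin.val_castSucc, Fin.val_succ] at hj hj'
    omega
  rw [← hx, hji]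
end

section
/- Let U : {0,1}* ⇀ {0,1}* be any partial function (a 'machine'), and for a binary string x define C_U(x) = min{ |p| : U(p) = x } ∈ ℕ ∪ {∞}, the length of a shortest U-description of x. Fix a constant c ∈ ℕ and define the deficiency of a string x of length n as D_n(x) = max(n + c − C_U(x), 0). Then for every n, the average of D_n(x) over all 2ⁿ binary strings x of length n is at most 2^{c+1}. -/
open scoped ENNReal

/-- The length of a shortest `U`-description of `x`, as an element of `ℝ≥0∞`
(with value `∞` if `x` has no description). -/
noncomputable def kolmogorovComplexity (U : List Bool → Option (List Bool))
    (x : List Bool) : ℝ≥0∞ :=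
  sInf {m : ℝ≥0∞ | ∃ p : List Bool, U p = some x ∧ m = p.length}

/-- The deficiency of `x` is at most the sum of `N - |p|` over all descriptions `p` of `x`
of length less than `N`. -/
theorem sub_kolmogorovComplexity_le (U : List Bool → Option (List Bool)) (N : ℕ)
    (x : List Bool) :
    (N : ℝ≥0∞) - kolmogorovComplexity U x ≤
      ((∑ k ∈ Finset.range N, ∑ p : Fin k → Bool,
        if U (List.ofFn p) = some x then N - k else 0 : ℕ) : ℝ≥0∞) := by
  rw [tsub_le_iff_left, ← tsub_le_iff_right]
  refine le_sInf ?_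
  rintro _ ⟨p, hp, rfl⟩
  rw [tsub_le_iff_right]
  norm_cast
  rw [← tsub_le_iff_left]
  rcases le_or_gt N p.length with h | h
  · simp [Nat.sub_eq_zero_of_le h]
  · calc N - p.length
        = if U (List.ofFn p.get) = some x then N - p.length else 0 := by simp [hp]
      _ ≤ ∑ q : Fin p.length → Bool, if U (List.ofFn q) = some x then N - p.length else 0 :=
          Finset.single_le_sum
            (f := fun q : Fin p.length → Bool ↦
              if U (List.ofFn q) = some x then N - p.length else 0)
            (fun _ _ ↦ Nat.zero_le _) (Finset.mem_univ p.get)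
      _ ≤ _ := Finset.single_le_sum
            (f := fun k ↦ ∑ q : Fin k → Bool, if U (List.ofFn q) = some x then N - k else 0)
            (fun _ _ ↦ Nat.zero_le _) (Finset.mem_range.2 h)

theorem sum_ite_eq_some_ofFn_le (o : Option (List Bool)) (n a : ℕ) :
    (∑ x : Fin n → Bool, if o = some (List.ofFn x) then a else 0) ≤ a := by
  rw [← Finset.sum_filter, Finset.sum_const, smul_eq_mul]
  refine mul_le_of_le_one_left (Nat.zero_le a) ?_
  rw [Finset.card_le_one]
  intro x hx y hy
  simp only [Finset.mem_filter, Finset.mem_univ, true_and] at hx hy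
  exact List.ofFn_injective (Option.some_injective _ (hx.symm.trans hy))

theorem sum_range_two_pow_mul_sub (N : ℕ) :
    (∑ k ∈ Finset.range N, 2 ^ k * (N - k)) + N + 2 = 2 ^ (N + 1) := by
  induction N with
  | zero => simp
  | succ N ih =>
    have h : ∑ k ∈ Finset.range N, 2 ^ (k + 1) * (N + 1 - (k + 1)) =
        2 * ∑ k ∈ Finset.range N, 2 ^ k * (N - k) := by
      rw [Finset.mul_sum]
      refine Finset.sum_congr rfl fun k _ ↦ ?_
      rw [Nat.add_sub_add_right, pow_succ]
      ring
    rw [Finset.sum_range_succ', h, pow_succ, ← ih]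
    simp
    ring

theorem sum_descriptions_le (U : List Bool → Option (List Bool)) (N n : ℕ) :
    (∑ x : Fin n → Bool, ∑ k ∈ Finset.range N, ∑ p : Fin k → Bool,
      if U (List.ofFn p) = some (List.ofFn x) then N - k else 0) ≤ 2 ^ (N + 1) := by
  rw [Finset.sum_comm]
  calc _ ≤ ∑ k ∈ Finset.range N, 2 ^ k * (N - k) := by
        refine Finset.sum_le_sum fun k _ ↦ ?_
        rw [Finset.sum_comm]
        refine (Finset.sum_le_sum fun p _ ↦ sum_ite_eq_some_ofFn_le _ n (N - k)).trans ?_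
        simp
    _ ≤ 2 ^ (N + 1) := by
        have := sum_range_two_pow_mul_sub N
        omega

/-- For any machine `U` and constant `c`, the average over all binary strings `x`
of length `n` of the deficiency `D_n(x) = max(n + c - C_U(x), 0)` is at most
`2 ^ (c + 1)`.  (Subtraction in `ℝ≥0∞` is truncated, and `n + c - ∞ = 0`.) -/
theorem average_plain_deficiency_le (U : List Bool → Option (List Bool)) (c n : ℕ) :
    (∑ x : Fin n → Bool,
        (((n : ℝ≥0∞) + (c : ℝ≥0∞)) - kolmogorovComplexity U (List.ofFn x))) / 2 ^ n
      ≤ 2 ^ (c + 1) := by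
  rw [ENNReal.div_le_iff (by positivity) (by simp), ← pow_add, ← Nat.cast_add]
  refine (Finset.sum_le_sum fun x _ ↦ sub_kolmogorovComplexity_le U (n + c) _).trans ?_
  have h := sum_descriptions_le U (n + c) n
  rw [show c + 1 + n = n + c + 1 by ring]
  exact_mod_cast h
end

section
/- Let f : {0,1}* → ℕ be a function satisfying the Kraft-type condition ∑_σ 2^{−f(σ)} ≤ 1, where the sum is over all finite binary strings σ. Let μ be the fair-coin (uniform Bernoulli product) probability measure on the space of infinite binary sequences {0,1}^ℕ. Then for every m ∈ ℕ, μ{ X ∈ {0,1}^ℕ : ∃ n, f(X↾n) < n − m } ≤ 2^{−m}. -/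
open MeasureTheory
open scoped ENNReal

/-- Let `μ` be the fair-coin measure on `{0,1}^ℕ`, i.e. the probability measure in
which each cylinder determined by a string of length `n` has measure `2^{-n}`.
If `f : {0,1}* → ℕ` satisfies the Kraft-type inequality `∑_σ 2^{-f(σ)} ≤ 1`, then
for every `m`, the `μ`-measure of the set of `X` having some initial segment `X↾n`
with `f(X↾n) < n - m` is at most `2^{-m}`. -/
theorem kraft_deficiency_measure_bound (f : List Bool → ℕ)
    (hf : (∑' σ : List Bool, (2 : ℝ≥0∞) ^ (-(f σ : ℤ))) ≤ 1)
    (μ : Measure (ℕ → Bool)) [IsProbabilityMeasure μ]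
    (hμ : ∀ (n : ℕ) (y : Fin n → Bool),
      μ {X : ℕ → Bool | ∀ i : Fin n, X i = y i} = ((2 : ℝ≥0∞) ^ n)⁻¹) :
    ∀ m : ℕ,
      μ {X : ℕ → Bool | ∃ n : ℕ, f (List.ofFn fun i : Fin n => X i) + m < n}
        ≤ ((2 : ℝ≥0∞) ^ m)⁻¹ := by
  intro m
  have hcover : {X : ℕ → Bool | ∃ n : ℕ, f (List.ofFn fun i : Fin n => X i) + m < n} ⊆
      ⋃ σ : List Bool, {X : ℕ → Bool | f σ + m < σ.length ∧ ∀ i : Fin σ.length, X i = σ.get i} := by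
    rintro X ⟨n, hn⟩
    exact Set.mem_iUnion.2 ⟨List.ofFn fun i : Fin n => X i, by simpa using hn, fun i => by simp⟩
  have hcylinder (σ : List Bool) :
      μ {X : ℕ → Bool | f σ + m < σ.length ∧ ∀ i : Fin σ.length, X i = σ.get i}
        ≤ (2 : ℝ≥0∞) ^ (-(f σ : ℤ)) * ((2 : ℝ≥0∞) ^ m)⁻¹ := by
    by_cases h : f σ + m < σ.length
    · simp only [h, true_and]
      rw [hμ, ENNReal.zpow_neg, zpow_natCast,
        ← ENNReal.mul_inv (Or.inl (by simp)) (Or.inl (by simp)), ← pow_add]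
      exact ENNReal.inv_le_inv.2 (pow_le_pow_right₀ one_le_two h.le)
    · simp [h]
  calc
    _ ≤ ∑' σ : List Bool, (2 : ℝ≥0∞) ^ (-(f σ : ℤ)) * ((2 : ℝ≥0∞) ^ m)⁻¹ :=
      (measure_mono hcover).trans <| (measure_iUnion_le _).trans (ENNReal.tsum_le_tsum hcylinder)
    _ = (∑' σ : List Bool, (2 : ℝ≥0∞) ^ (-(f σ : ℤ))) * ((2 : ℝ≥0∞) ^ m)⁻¹ := ENNReal.tsum_mul_right
    _ ≤ ((2 : ℝ≥0∞) ^ m)⁻¹ := mul_le_of_le_one_left' hf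
end

section
/- Let f : {0,1}* → ℕ satisfy the Kraft-type condition ∑_σ 2^{−f(σ)} ≤ 1 (sum over all finite binary strings σ), and let μ be the fair-coin probability measure on {0,1}^ℕ. Fix a ∈ ℕ and define the truncated deficiency process D_n⁺(X) = max( n − f(X↾n) − a, 0 ). Then the expectation with respect to μ of sup_n D_n⁺(X) is at most 2^{1−a}. -/
open MeasureTheory
open scoped ENNReal

/-- Truncated subtraction is dominated by the corresponding power of two. -/
theorem natCast_sub_sub_le_two_zpow (n k a : ℕ) :
    (n : ℝ≥0∞) - k - a ≤ 2 ^ n * (2 ^ (-(k : ℤ)) * 2 ^ (-(a : ℤ))) := by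
  rw [← ENNReal.natCast_sub, ← ENNReal.natCast_sub, ← zpow_natCast,
    ← ENNReal.zpow_add two_ne_zero ENNReal.ofNat_ne_top,
    ← ENNReal.zpow_add two_ne_zero ENNReal.ofNat_ne_top]
  rcases Nat.eq_zero_or_pos (n - k - a) with h | h
  · simp [h]
  · have e : (n : ℤ) + (-(k : ℤ) + -(a : ℤ)) = ((n - k - a : ℕ) : ℤ) := by omega
    rw [e, zpow_natCast]
    exact_mod_cast Nat.lt_two_pow_self.le

/-- Under the fair-coin measure, integrating a function of the first `n` bits amounts to averaging
over the strings of length `n`. -/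
theorem lintegral_two_pow_mul_initialSegment (μ : Measure (ℕ → Bool)) (n : ℕ)
    (hμ : ∀ y : Fin n → Bool,
      μ {X : ℕ → Bool | ∀ i : Fin n, X i = y i} = ((2 : ℝ≥0∞) ^ n)⁻¹)
    (g : (Fin n → Bool) → ℝ≥0∞) :
    ∫⁻ X, 2 ^ n * g (fun i : Fin n => X i) ∂μ = ∑ y, g y := by
  have hm : Measurable fun (X : ℕ → Bool) (i : Fin n) => X i := by fun_prop
  rw [← lintegral_map (f := fun y => 2 ^ n * g y) (measurable_of_finite _) hm, lintegral_fintype]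
  refine Finset.sum_congr rfl fun y _ => ?_
  have hset : (fun (X : ℕ → Bool) (i : Fin n) => X i) ⁻¹' {y} =
      {X : ℕ → Bool | ∀ i : Fin n, X i = y i} := by
    ext X
    simp [funext_iff]
  rw [Measure.map_apply hm (measurableSet_singleton y), hset, hμ, mul_right_comm,
    ENNReal.mul_inv_cancel (by simp) (by simp), one_mul]

/-- Let `μ` be the fair-coin measure on `{0,1}^ℕ` (each cylinder determined by a
string of length `n` has measure `2^{-n}`).  If `f : {0,1}* → ℕ` satisfies the
Kraft-type inequality `∑_σ 2^{-f(σ)} ≤ 1`, and `a ∈ ℕ`, then the `μ`-expectation of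
`sup_n D_n⁺(X)`, where `D_n⁺(X) = max(n - f(X↾n) - a, 0)` (truncated subtraction in
`ℝ≥0∞`), is at most `2^{1-a}`. -/
theorem kraft_truncated_deficiency_expectation_bound (f : List Bool → ℕ) (a : ℕ)
    (hf : (∑' σ : List Bool, (2 : ℝ≥0∞) ^ (-(f σ : ℤ))) ≤ 1)
    (μ : Measure (ℕ → Bool)) [IsProbabilityMeasure μ]
    (hμ : ∀ (n : ℕ) (y : Fin n → Bool),
      μ {X : ℕ → Bool | ∀ i : Fin n, X i = y i} = ((2 : ℝ≥0∞) ^ n)⁻¹) :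
    (∫⁻ X, (⨆ n : ℕ,
        ((n : ℝ≥0∞) - (f (List.ofFn fun i : Fin n => X i) : ℝ≥0∞) - (a : ℝ≥0∞))) ∂μ)
      ≤ (2 : ℝ≥0∞) ^ (1 - (a : ℤ)) := by
  have hm (n : ℕ) : Measurable fun (X : ℕ → Bool) (i : Fin n) => X i := by fun_prop
  let g (n : ℕ) (y : Fin n → Bool) : ℝ≥0∞ :=
    2 ^ (-(f (List.ofFn y) : ℤ)) * 2 ^ (-(a : ℤ))
  calc
    _ ≤ ∫⁻ X, ∑' n, 2 ^ n * g n (fun i : Fin n => X i) ∂μ :=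
      lintegral_mono fun X => iSup_le fun n =>
        (natCast_sub_sub_le_two_zpow n _ a).trans (ENNReal.le_tsum n)
    _ = ∑' n, ∫⁻ X, 2 ^ n * g n (fun i : Fin n => X i) ∂μ :=
      lintegral_tsum fun n =>
        ((measurable_of_finite fun y => 2 ^ n * g n y).comp (hm n)).aemeasurable
    _ = ∑' n, ∑' y : Fin n → Bool, g n y := by
      refine tsum_congr fun n => ?_
      rw [lintegral_two_pow_mul_initialSegment μ n (hμ n), tsum_fintype]
    _ = ∑' σ : List Bool, (2 : ℝ≥0∞) ^ (-(f σ : ℤ)) * 2 ^ (-(a : ℤ)) := by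
      rw [← ENNReal.tsum_sigma g, ← List.equivSigmaTuple.symm.tsum_eq]
      rfl
    _ ≤ 1 * 2 ^ (-(a : ℤ)) := by
      rw [ENNReal.tsum_mul_right]
      gcongr
    _ ≤ 2 ^ (1 - (a : ℤ)) := by
      rw [one_mul]
      exact ENNReal.zpow_le_of_le (by norm_num) (by omega)
end

section
/- Let Ω_N = {0,1}^N with the uniform probability measure and natural filtration, let Gₙ be the current run of heads process and R_N the longest run of heads, and define the run option price V_N^A as the supremum, over all stopping times τ with values in {0,…,N} ∪ {∞}, of E[ 1_{τ ≤ N} · G_τ ]. Assume there exist constants C > 0 and N₀ such that for all N ≥ N₀, |E(R_N) − log₂ N| ≤ C and Var(R_N) ≤ 4. Then V_N^A is asymptotic to log₂ N, i.e., lim_{N→∞} V_N^A / log₂ N = 1. -/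
open MeasureTheory
open scoped ENNReal

/-- The current run of heads at time `n` (0-indexed coordinates; `true` = heads):
the largest `r ≤ n` such that coordinates `n - r, …, n - 1` are all heads. -/
noncomputable def runG (N : ℕ) (ω : Fin N → Bool) (n : ℕ) : ℕ :=
  sSup {r : ℕ | r ≤ n ∧ ∀ i : Fin N, n - r ≤ (i : ℕ) → (i : ℕ) < n → ω i = true}

/-- The longest run of heads: `R_N = max_{0 ≤ n ≤ N} G_n`. -/
noncomputable def runR (N : ℕ) (ω : Fin N → Bool) : ℕ :=
  (Finset.range (N + 1)).sup (runG N ω)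

/-- The natural filtration on `{0,1}^N`: `F n` is generated by the first `n`
coordinates. -/
def coordFiltration (N : ℕ) (n : ℕ) : MeasurableSpace (Fin N → Bool) :=
  MeasurableSpace.comap
    (fun ω => (fun i : {i : Fin N // (i : ℕ) < n} => ω i.1)) inferInstance

/-- `E(R_N)` under the uniform measure on `{0,1}^N`. -/
noncomputable def meanR (N : ℕ) : ℝ :=
  (∑ ω : Fin N → Bool, (runR N ω : ℝ)) / 2 ^ N

/-- `Var(R_N)` under the uniform measure on `{0,1}^N`. -/
noncomputable def varR (N : ℕ) : ℝ :=
  (∑ ω : Fin N → Bool, ((runR N ω : ℝ) - meanR N) ^ 2) / 2 ^ N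

/-- The run option price `V_N^A`: the supremum over stopping times
`τ : {0,1}^N → ℕ ∪ {∞}` of `E[1_{τ ≤ N} · G_τ]` under the uniform measure. -/
noncomputable def runOptionPrice (N : ℕ) : ℝ :=
  sSup {v : ℝ | ∃ τ : (Fin N → Bool) → ℕ∞,
    (∀ n : ℕ, MeasurableSet[coordFiltration N n] {ω | τ ω ≤ (n : ℕ∞)}) ∧
    v = (∑ ω : Fin N → Bool,
          if τ ω ≤ (N : ℕ∞) then (runG N ω ((τ ω).toNat) : ℝ) else 0) / 2 ^ N}

/-- The current run of heads at time `n` depends only on the first `n` coordinates. -/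
lemma runG_congr {N n : ℕ} {ω ω' : Fin N → Bool}
    (h : ∀ i : Fin N, (i : ℕ) < n → ω i = ω' i) : runG N ω n = runG N ω' n := by
  unfold runG
  congr 1
  ext r
  constructor
  · rintro ⟨h₁, h₂⟩
    exact ⟨h₁, fun i hi hin => h i hin ▸ h₂ i hi hin⟩
  · rintro ⟨h₁, h₂⟩
    exact ⟨h₁, fun i hi hin => (h i hin).symm ▸ h₂ i hi hin⟩

/-- A set determined by the first `n` coordinates belongs to the `n`-th σ-algebra. -/
lemma measurableSet_coordFiltration {N n : ℕ} {s : Set (Fin N → Bool)}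
    (h : ∀ ω ω' : Fin N → Bool, (∀ i : Fin N, (i : ℕ) < n → ω i = ω' i) → ω ∈ s → ω' ∈ s) :
    MeasurableSet[coordFiltration N n] s := by
  refine ⟨(fun ω => (fun i : {i : Fin N // (i : ℕ) < n} => ω i.1)) '' s,
    (Set.toFinite _).measurableSet, ?_⟩
  ext ω'
  constructor
  · rintro ⟨ω, hω, he⟩
    exact h ω ω' (fun i hi => congrFun he ⟨i, hi⟩) hω
  · exact fun hω => ⟨ω', hω, rfl⟩

lemma runG_le_runR {N n : ℕ} (ω : Fin N → Bool) (hn : n ≤ N) : runG N ω n ≤ runR N ω :=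
  Finset.le_sup (f := runG N ω) (Finset.mem_range.2 (Nat.lt_succ_of_le hn))

lemma exists_runG_eq_runR (N : ℕ) (ω : Fin N → Bool) : ∃ n ≤ N, runG N ω n = runR N ω := by
  obtain ⟨n, hn, h⟩ := Finset.exists_mem_eq_sup (Finset.range (N + 1)) ⟨0, by simp⟩ (runG N ω)
  exact ⟨n, Nat.le_of_lt_succ (Finset.mem_range.1 hn), h.symm⟩

/-- The expected payoff of any random time is at most the mean of the longest run. -/
lemma payoff_le_meanR {N : ℕ} (τ : (Fin N → Bool) → ℕ∞) :
    (∑ ω : Fin N → Bool, if τ ω ≤ (N : ℕ∞) then (runG N ω ((τ ω).toNat) : ℝ) else 0) / 2 ^ N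
      ≤ meanR N := by
  unfold meanR
  gcongr with ω
  split_ifs with h
  · exact_mod_cast runG_le_runR ω (ENat.toNat_le_of_le_natCast h)
  · positivity

lemma runOptionPrice_le_meanR (N : ℕ) : runOptionPrice N ≤ meanR N := by
  refine Real.sSup_le ?_ (by unfold meanR; positivity)
  rintro v ⟨τ, -, rfl⟩
  exact payoff_le_meanR τ

lemma payoff_le_runOptionPrice {N : ℕ} {τ : (Fin N → Bool) → ℕ∞}
    (hτ : ∀ n : ℕ, MeasurableSet[coordFiltration N n] {ω | τ ω ≤ (n : ℕ∞)}) :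
    (∑ ω : Fin N → Bool, if τ ω ≤ (N : ℕ∞) then (runG N ω ((τ ω).toNat) : ℝ) else 0) / 2 ^ N
      ≤ runOptionPrice N := by
  refine le_csSup ⟨meanR N, ?_⟩ ⟨τ, hτ, rfl⟩
  rintro v ⟨σ, -, rfl⟩
  exact payoff_le_meanR σ

open Classical in
/-- The first time at most `N` at which the current run of heads has length at least `k`. -/
noncomputable def hittingRun (N k : ℕ) (ω : Fin N → Bool) : ℕ∞ :=
  if h : ∃ n, n ≤ N ∧ k ≤ runG N ω n then (Nat.find h : ℕ∞) else ⊤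

lemma hittingRun_le_iff {N k n : ℕ} {ω : Fin N → Bool} :
    hittingRun N k ω ≤ (n : ℕ∞) ↔ ∃ m ≤ n, m ≤ N ∧ k ≤ runG N ω m := by
  classical
  unfold hittingRun
  split_ifs with h
  · rw [Nat.cast_le, Nat.find_le_iff]
  · constructor
    · intro h'
      simp at h'
    · rintro ⟨m, -, hm⟩
      exact absurd ⟨m, hm⟩ h

lemma le_runG_hittingRun {N k : ℕ} {ω : Fin N → Bool} (h : hittingRun N k ω ≤ (N : ℕ∞)) :
    k ≤ runG N ω (hittingRun N k ω).toNat := by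
  classical
  obtain ⟨m, -, hm⟩ := hittingRun_le_iff.1 h
  have h' : ∃ n, n ≤ N ∧ k ≤ runG N ω n := ⟨m, hm⟩
  rw [hittingRun, dif_pos h', ENat.toNat_natCast]
  exact (Nat.find_spec h').2

lemma measurableSet_hittingRun_le (N k n : ℕ) :
    MeasurableSet[coordFiltration N n] {ω | hittingRun N k ω ≤ (n : ℕ∞)} := by
  refine measurableSet_coordFiltration fun ω ω' h hω => ?_
  obtain ⟨m, hmn, hmN, hk⟩ := hittingRun_le_iff.1 hω
  refine hittingRun_le_iff.2 ⟨m, hmn, hmN, ?_⟩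
  rwa [← runG_congr fun i hi => h i (hi.trans_le hmn)]

/-- Chebyshev lower bound: waiting for a run of length `E(R_N) - t`. -/
lemma mul_one_sub_le_runOptionPrice {N : ℕ} {t : ℝ} (ht : 0 < t) (hx : 0 ≤ meanR N - t) :
    (meanR N - t) * (1 - varR N / t ^ 2) ≤ runOptionPrice N := by
  refine le_trans ?_
    (payoff_le_runOptionPrice (measurableSet_hittingRun_le N ⌈meanR N - t⌉₊))
  have hsum : (meanR N - t) * (1 - varR N / t ^ 2) =
      (∑ ω : Fin N → Bool,
        (meanR N - t) * (1 - ((runR N ω : ℝ) - meanR N) ^ 2 / t ^ 2)) / 2 ^ N := by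
    rw [← Finset.mul_sum, Finset.sum_sub_distrib, ← Finset.sum_div]
    simp only [varR, Finset.sum_const, Finset.card_univ, Fintype.card_pi, Fintype.card_bool,
      Finset.prod_const, Fintype.card_fin, nsmul_eq_mul, Nat.cast_pow, Nat.cast_ofNat, mul_one]
    field_simp
  rw [hsum]
  gcongr with ω
  split_ifs with h
  · calc (meanR N - t) * (1 - ((runR N ω : ℝ) - meanR N) ^ 2 / t ^ 2)
        ≤ meanR N - t := mul_le_of_le_one_right hx (sub_le_self _ (by positivity))
      _ ≤ (⌈meanR N - t⌉₊ : ℝ) := Nat.le_ceil _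
      _ ≤ _ := by exact_mod_cast le_runG_hittingRun h
  · refine mul_nonpos_of_nonneg_of_nonpos hx (sub_nonpos.2 ?_)
    have hlt : (runR N ω : ℝ) < meanR N - t := by
      by_contra! hle
      obtain ⟨n, hn, he⟩ := exists_runG_eq_runR N ω
      exact h (hittingRun_le_iff.2 ⟨n, hn, hn, he ▸ Nat.ceil_le.2 hle⟩)
    rw [one_le_div (by positivity)]
    nlinarith

/-- Assuming `|E(R_N) - log₂ N| ≤ C` and `Var(R_N) ≤ 4` for all large `N`, the run
option price is asymptotic to `log₂ N`: `V_N^A / log₂ N → 1`. -/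
theorem runOptionPrice_asymptotic (C : ℝ) (hC : 0 < C) (N₀ : ℕ)
    (hE : ∀ N : ℕ, N₀ ≤ N → |meanR N - Real.logb 2 N| ≤ C)
    (hV : ∀ N : ℕ, N₀ ≤ N → varR N ≤ 4) :
    Filter.Tendsto (fun N : ℕ => runOptionPrice N / Real.logb 2 N)
      Filter.atTop (nhds 1) := by
  have hL : Filter.Tendsto (fun N : ℕ => Real.logb 2 N) Filter.atTop Filter.atTop :=
    (Real.tendsto_logb_atTop one_lt_two).comp tendsto_natCast_atTop_atTop
  have hS := Real.tendsto_sqrt_atTop.comp hL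
  have hi := tendsto_inv_atTop_zero.comp hL
  have hs := tendsto_inv_atTop_zero.comp hS
  have lower : Filter.Tendsto (fun N : ℕ => (1 - C * (Real.logb 2 N)⁻¹ - (√(Real.logb 2 N))⁻¹)
      * (1 - 4 * (Real.logb 2 N)⁻¹)) Filter.atTop (nhds 1) := by
    simpa using (((hi.const_mul C).const_sub 1).sub hs).mul ((hi.const_mul 4).const_sub 1)
  have upper : Filter.Tendsto (fun N : ℕ => 1 + C * (Real.logb 2 N)⁻¹) Filter.atTop (nhds 1) := by
    simpa using (hi.const_mul C).const_add 1
  refine tendsto_of_tendsto_of_tendsto_of_le_of_le' lower upper ?_ ?_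
  · filter_upwards [Filter.eventually_ge_atTop N₀, hL.eventually_ge_atTop 4,
      hS.eventually_ge_atTop (C + 1)] with N hN hL4 hSC
    have hE' := (abs_le.1 (hE N hN)).1
    have hV' := hV N hN
    simp only [Function.comp_apply] at hSC
    set L := Real.logb 2 N
    have hL0 : 0 < L := by linarith
    have hs0 : 0 < √L := Real.sqrt_pos.2 hL0
    have hsq : √L ^ 2 = L := Real.sq_sqrt hL0.le
    have hx : 0 ≤ L - C - √L := by nlinarith
    have hb := mul_one_sub_le_runOptionPrice (N := N) hs0 (by linarith)
    rw [hsq] at hb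
    rw [le_div_iff₀ hL0]
    have h4 : 0 ≤ 1 - 4 / L := sub_nonneg.2 ((div_le_one hL0).2 hL4)
    calc (1 - C * L⁻¹ - (√L)⁻¹) * (1 - 4 * L⁻¹) * L
        = (L - C - √L) * (1 - 4 / L) := by
          have hinv : (√L)⁻¹ * L = √L := by
            rw [inv_mul_eq_iff_eq_mul₀ hs0.ne', ← sq, hsq]
          have hone : L⁻¹ * L = 1 := inv_mul_cancel₀ hL0.ne'
          rw [div_eq_mul_inv]
          linear_combination (-(1 - 4 * L⁻¹)) * hinv - C * (1 - 4 * L⁻¹) * hone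
      _ ≤ (meanR N - √L) * (1 - varR N / L) := by
          gcongr <;> linarith
      _ ≤ runOptionPrice N := hb
  · filter_upwards [Filter.eventually_ge_atTop N₀, hL.eventually_gt_atTop 0] with N hN hL0
    have hE' := (abs_le.1 (hE N hN)).2
    rw [div_le_iff₀ hL0, add_mul, one_mul, mul_assoc, inv_mul_cancel₀ hL0.ne', mul_one]
    linarith [runOptionPrice_le_meanR N]
end
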